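/- For the lifted Heisenberg structure on ℝ³ × ℝ³ there exists a constant C₀ > 0, independent of ε > 0, such that for all x, y, z ∈ ℝ³: d̄_ε((x,z), (y,z)) ≥ d_ε(x,y) − C₀, where d̄_ε is the Carnot–Carathéodory distance on ℝ⁶ generated by the frame X₁, X₂, Ẑ₁, Ẑ₂, Ẑ₃ + εX₃ and d_ε is the distance on ℝ³ for which X₁, X₂, εX₃ are orthonormal. -/

import Mathlib

/-!
STATEMENT 10: For the lifted Heisenberg structure on `ℝ³ × ℝ³` there is `C₀ > 0`,
independent of `ε > 0`, with `d̄_ε((x,z),(y,z)) ≥ d_ε(x,y) − C₀`.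
-/

open MeasureTheory Set

noncomputable section

/-- The left-invariant horizontal field `X₁ = ∂_{x₁} − x₂ ∂_{x₃}` of `ℍ¹`. -/
def hX1 : (Fin 3 → ℝ) → (Fin 3 → ℝ) := fun x => ![1, 0, -x 1]

/-- The left-invariant horizontal field `X₂ = ∂_{x₂} + x₁ ∂_{x₃}` of `ℍ¹`. -/
def hX2 : (Fin 3 → ℝ) → (Fin 3 → ℝ) := fun x => ![0, 1, x 0]

/-- The vertical field `X₃ = ∂_{x₃}`. -/
def hX3 : (Fin 3 → ℝ) → (Fin 3 → ℝ) := fun _ => ![0, 0, 1]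

/-- The Heisenberg group product. -/
def hMul (x y : Fin 3 → ℝ) : Fin 3 → ℝ :=
  ![x 0 + y 0, x 1 + y 1, x 2 + y 2 - (x 1 * y 0 - x 0 * y 1)]

/-- The Heisenberg group inverse. -/
def hInv (y : Fin 3 → ℝ) : Fin 3 → ℝ := ![-y 0, -y 1, -y 2]

/-- The Korányi gauge `|x| = ((x₁²+x₂²)² + x₃²)^{1/4}`. -/
def hGauge (x : Fin 3 → ℝ) : ℝ := ((x 0 ^ 2 + x 1 ^ 2) ^ 2 + x 2 ^ 2) ^ ((1 : ℝ) / 4)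

/-- The Carnot–Carathéodory distance of the horizontal frame `(X₁, X₂)`: the infimum
over horizontal absolutely continuous curves joining `x` to `y` of the essential
supremum of `√(a₁² + a₂²)`. -/
def dH0 (x y : Fin 3 → ℝ) : ℝ :=
  sInf {δ : ℝ | ∃ γ : ℝ → Fin 3 → ℝ, ∃ a₁ a₂ : ℝ → ℝ,
    γ 0 = x ∧ γ 1 = y ∧ (∃ L, LipschitzOnWith L γ (Set.Icc 0 1)) ∧
    ∀ᵐ t ∂(volume.restrict (Set.Icc (0 : ℝ) 1)),
      HasDerivAt γ (a₁ t • hX1 (γ t) + a₂ t • hX2 (γ t)) t ∧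
      Real.sqrt (a₁ t ^ 2 + a₂ t ^ 2) ≤ δ}

/-- The Riemannian distance `d_ε` for which `X₁, X₂, εX₃` is an orthonormal frame:
the infimum of `∫₀¹ √(a₁² + a₂² + ε⁻²a₃²) dt` over a.e. tangent curves from `x` to `y`. -/
def dHeps (ε : ℝ) (x y : Fin 3 → ℝ) : ℝ :=
  sInf {ℓ : ℝ | ∃ γ : ℝ → Fin 3 → ℝ, ∃ a : Fin 3 → ℝ → ℝ,
    γ 0 = x ∧ γ 1 = y ∧ (∃ L, LipschitzOnWith L γ (Set.Icc 0 1)) ∧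
    (∀ᵐ t ∂(volume.restrict (Set.Icc (0 : ℝ) 1)),
      HasDerivAt γ (a 0 t • hX1 (γ t) + a 1 t • hX2 (γ t) + a 2 t • hX3 (γ t)) t) ∧
    ℓ = ∫ t in (0:ℝ)..1, Real.sqrt (a 0 t ^ 2 + a 1 t ^ 2 + ε⁻¹ ^ 2 * a 2 t ^ 2)}

/-- Lift of `X₁` to `ℝ⁶` (acting in the first three variables). -/
def lX1 : (Fin 6 → ℝ) → (Fin 6 → ℝ) := fun q => ![1, 0, -q 1, 0, 0, 0]

/-- Lift of `X₂` to `ℝ⁶`. -/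
def lX2 : (Fin 6 → ℝ) → (Fin 6 → ℝ) := fun q => ![0, 1, q 0, 0, 0, 0]

/-- `Ẑ₁ = ∂_{z₁} + z₂ ∂_{z₃}`, acting in the last three variables. -/
def lZ1 : (Fin 6 → ℝ) → (Fin 6 → ℝ) := fun q => ![0, 0, 0, 1, 0, q 4]

/-- `Ẑ₂ = ∂_{z₂} − z₁ ∂_{z₃}`. -/
def lZ2 : (Fin 6 → ℝ) → (Fin 6 → ℝ) := fun q => ![0, 0, 0, 0, 1, -q 3]

/-- `Ẑ₃ + ε X₃`. -/
def lZ3eps (ε : ℝ) : (Fin 6 → ℝ) → (Fin 6 → ℝ) := fun _ => ![0, 0, ε, 0, 0, 1]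

/-- The lifted Carnot–Carathéodory distance `d̄_ε` on `ℝ⁶`, generated by the frame
`X₁, X₂, Ẑ₁, Ẑ₂, Ẑ₃ + εX₃`. -/
def dLift (ε : ℝ) (q q' : Fin 6 → ℝ) : ℝ :=
  sInf {ℓ : ℝ | ∃ γ : ℝ → Fin 6 → ℝ, ∃ b : Fin 5 → ℝ → ℝ,
    γ 0 = q ∧ γ 1 = q' ∧ (∃ L, LipschitzOnWith L γ (Set.Icc 0 1)) ∧
    (∀ᵐ t ∂(volume.restrict (Set.Icc (0 : ℝ) 1)),
      HasDerivAt γ (b 0 t • lX1 (γ t) + b 1 t • lX2 (γ t) + b 2 t • lZ1 (γ t) +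
        b 3 t • lZ2 (γ t) + b 4 t • lZ3eps ε (γ t)) t) ∧
    ℓ = ∫ t in (0:ℝ)..1, Real.sqrt (∑ i, (b i t) ^ 2)}

/-- Concatenation `(x, z) ∈ ℝ³ × ℝ³ ↦ ℝ⁶`. -/
def hJoin (x z : Fin 3 → ℝ) : Fin 6 → ℝ := Fin.append x z

/-- The coefficients of an admissible lifted curve are integrable, and so is its speed. -/
lemma integrable_speed_of_lift {ε : ℝ} {γ : ℝ → Fin 6 → ℝ} {b : Fin 5 → ℝ → ℝ}
    (hL : ∃ L, LipschitzOnWith L γ (Set.Icc 0 1))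
    (hγ : ∀ᵐ t ∂(volume.restrict (Set.Icc (0 : ℝ) 1)),
      HasDerivAt γ (b 0 t • lX1 (γ t) + b 1 t • lX2 (γ t) + b 2 t • lZ1 (γ t) +
        b 3 t • lZ2 (γ t) + b 4 t • lZ3eps ε (γ t)) t) :
    IntegrableOn (fun t => Real.sqrt (∑ i, (b i t) ^ 2)) (Set.Icc 0 1) := by
  obtain ⟨L, hL⟩ := hL
  have hbound : ∀ᵐ t ∂(volume.restrict (Set.Icc (0 : ℝ) 1)), ‖deriv γ t‖ ≤ L := by
    rw [← restrict_Ioo_eq_restrict_Icc, ae_restrict_iff' measurableSet_Ioo]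
    exact Filter.Eventually.of_forall fun t ht =>
      norm_deriv_le_of_lipschitzOn (Icc_mem_nhds ht.1 ht.2) hL
  have hderiv : ∀ i, IntegrableOn (fun t => deriv γ t i) (Set.Icc 0 1) := fun i =>
    IntegrableOn.of_bound measure_Icc_lt_top
      ((measurable_pi_apply i).comp (measurable_deriv γ)).aestronglyMeasurable L
      (hbound.mono fun t ht => (norm_le_pi_norm (deriv γ t) i).trans ht)
  have hcont : ∀ i, ContinuousOn (fun t => γ t i) (Set.Icc 0 1) := fun i =>
    (continuous_apply i).comp_continuousOn hL.continuousOn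
  have h0 : IntegrableOn (b 0) (Set.Icc 0 1) := (hderiv 0).congr <| hγ.mono fun t ht => by
    simp [ht.deriv, lX1, lX2, lZ1, lZ2, lZ3eps]
  have h1 : IntegrableOn (b 1) (Set.Icc 0 1) := (hderiv 1).congr <| hγ.mono fun t ht => by
    simp [ht.deriv, lX1, lX2, lZ1, lZ2, lZ3eps]
  have h2 : IntegrableOn (b 2) (Set.Icc 0 1) := (hderiv 3).congr <| hγ.mono fun t ht => by
    simp [ht.deriv, lX1, lX2, lZ1, lZ2, lZ3eps]
  have h3 : IntegrableOn (b 3) (Set.Icc 0 1) := (hderiv 4).congr <| hγ.mono fun t ht => by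
    simp [ht.deriv, lX1, lX2, lZ1, lZ2, lZ3eps]
  have h4 : IntegrableOn (b 4) (Set.Icc 0 1) :=
    (((hderiv 5).sub (h2.continuousOn_mul (hcont 4) isCompact_Icc)).add
      (h3.continuousOn_mul (hcont 3) isCompact_Icc)).congr <| hγ.mono fun t ht => by
        simp [ht.deriv, lX1, lX2, lZ1, lZ2, lZ3eps]
        ring
  have hb : ∀ i, IntegrableOn (b i) (Set.Icc 0 1) := by
    intro i
    fin_cases i
    exacts [h0, h1, h2, h3, h4]
  refine Integrable.mono' (g := fun t => ∑ i, |b i t|)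
    (integrable_finsetSum _ fun i _ => (hb i).abs) ?_ ?_
  · refine Real.continuous_sqrt.comp_aestronglyMeasurable ?_
    exact Finset.aestronglyMeasurable_fun_sum _ fun i _ => (hb i).aestronglyMeasurable.pow 2
  · refine Filter.Eventually.of_forall fun t => ?_
    rw [Real.norm_of_nonneg (Real.sqrt_nonneg _)]
    refine Real.sqrt_le_iff.2 ⟨Finset.sum_nonneg fun i _ => abs_nonneg _, ?_⟩
    calc ∑ i, b i t ^ 2 = ∑ i, |b i t| ^ 2 := by simp
      _ ≤ (∑ i, |b i t|) ^ 2 := Finset.sum_sq_le_sq_sum_of_nonneg fun i _ => abs_nonneg _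

/-- Over two points with the same fibre coordinate the lifted frame is controllable: a straight
line in `x` together with a polynomial loop in `z` enclosing the right area. -/
lemma exists_lift_curve {ε : ℝ} (hε : 0 < ε) (x y z : Fin 3 → ℝ) :
    ∃ γ : ℝ → Fin 6 → ℝ, ∃ b : Fin 5 → ℝ → ℝ,
      γ 0 = hJoin x z ∧ γ 1 = hJoin y z ∧ (∃ L, LipschitzOnWith L γ (Set.Icc 0 1)) ∧
      ∀ t, HasDerivAt γ (b 0 t • lX1 (γ t) + b 1 t • lX2 (γ t) + b 2 t • lZ1 (γ t) +
        b 3 t • lZ2 (γ t) + b 4 t • lZ3eps ε (γ t)) t := by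
  obtain ⟨c, hc⟩ : ∃ c : ℝ, ε * c = y 2 - x 2 - (x 0 * (y 1 - x 1) - x 1 * (y 0 - x 0)) :=
    ⟨(y 2 - x 2 - (x 0 * (y 1 - x 1) - x 1 * (y 0 - x 0))) / ε, by field_simp⟩
  let γ : ℝ → Fin 6 → ℝ := fun t =>
    ![x 0 + (y 0 - x 0) * t, x 1 + (y 1 - x 1) * t, x 2 + (y 2 - x 2) * t,
      z 0 + -15 * c * (t - t ^ 2), z 1 + (t - 3 * t ^ 2 + 2 * t ^ 3),
      z 2 + z 1 * (-15 * c * (t - t ^ 2)) - z 0 * (t - 3 * t ^ 2 + 2 * t ^ 3)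
        + -15 * c * (2 / 3 * t ^ 3 - t ^ 4 + 2 / 5 * t ^ 5) + c * t]
  refine ⟨γ, ![fun _ => y 0 - x 0, fun _ => y 1 - x 1, fun t => -15 * c * (1 - 2 * t),
    fun t => 1 - 6 * t + 6 * t ^ 2, fun _ => c], ?_, ?_, ?_, ?_⟩
  · ext i
    fin_cases i <;> simp [γ, hJoin, Fin.append, Fin.addCases]
  · ext i
    fin_cases i <;> simp [γ, hJoin, Fin.append, Fin.addCases] <;> ring
  · have hγ : ContDiff ℝ 1 γ := by
      refine contDiff_pi.2 fun i => ?_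
      fin_cases i <;> simp [γ] <;> fun_prop
    exact hγ.contDiffOn.exists_lipschitzOnWith one_ne_zero (convex_Icc 0 1) isCompact_Icc
  · intro t
    have h1 : HasDerivAt (fun t : ℝ => t) 1 t := hasDerivAt_id t
    have h2 := h1.fun_pow 2
    have h3 := h1.fun_pow 3
    have h4 := h1.fun_pow 4
    have h5 := h1.fun_pow 5
    have hφ := (h1.sub h2).const_mul (-15 * c)
    have hψ := (h1.sub (h2.const_mul 3)).add (h3.const_mul 2)
    have hω := (((h3.const_mul (2 / 3)).sub h4).add (h5.const_mul (2 / 5))).const_mul (-15 * c)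
    refine hasDerivAt_pi.2 fun i => ?_
    fin_cases i
    · refine ((h1.const_mul (y 0 - x 0)).const_add (x 0)).congr_deriv ?_
      simp [lX1, lX2, lZ1, lZ2, lZ3eps]
    · refine ((h1.const_mul (y 1 - x 1)).const_add (x 1)).congr_deriv ?_
      simp [lX1, lX2, lZ1, lZ2, lZ3eps]
    · refine ((h1.const_mul (y 2 - x 2)).const_add (x 2)).congr_deriv ?_
      simp [γ, lX1, lX2, lZ1, lZ2, lZ3eps]
      linear_combination -hc
    · refine (hφ.const_add (z 0)).congr_deriv ?_
      simp [lX1, lX2, lZ1, lZ2, lZ3eps]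
    · refine (hψ.const_add (z 1)).congr_deriv ?_
      simp [lX1, lX2, lZ1, lZ2, lZ3eps]
      ring
    · refine (((((hφ.const_mul (z 1)).const_add (z 2)).sub (hψ.const_mul (z 0))).add hω).add
        (h1.const_mul c)).congr_deriv ?_
      simp [γ, lX1, lX2, lZ1, lZ2, lZ3eps]
      ring

/-- The base distance is at most the length of any admissible lifted curve: project the curve to
the first factor. -/
lemma dHeps_le_length_of_lift {ε : ℝ} (hε : 0 < ε) {x y z w : Fin 3 → ℝ}
    {γ : ℝ → Fin 6 → ℝ} {b : Fin 5 → ℝ → ℝ}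
    (h0 : γ 0 = hJoin x z) (h1 : γ 1 = hJoin y w)
    (hL : ∃ L, LipschitzOnWith L γ (Set.Icc 0 1))
    (hγ : ∀ᵐ t ∂(volume.restrict (Set.Icc (0 : ℝ) 1)),
      HasDerivAt γ (b 0 t • lX1 (γ t) + b 1 t • lX2 (γ t) + b 2 t • lZ1 (γ t) +
        b 3 t • lZ2 (γ t) + b 4 t • lZ3eps ε (γ t)) t) :
    dHeps ε x y ≤ ∫ t in (0 : ℝ)..1, Real.sqrt (∑ i, (b i t) ^ 2) := by
  have hint := integrable_speed_of_lift hL hγ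
  obtain ⟨L, hL⟩ := hL
  let a : Fin 3 → ℝ → ℝ := ![b 0, b 1, fun t => ε * b 4 t]
  have hle : (∫ t in (0 : ℝ)..1, Real.sqrt (a 0 t ^ 2 + a 1 t ^ 2 + ε⁻¹ ^ 2 * a 2 t ^ 2)) ≤
      ∫ t in (0 : ℝ)..1, Real.sqrt (∑ i, (b i t) ^ 2) := by
    rw [intervalIntegral.integral_of_le zero_le_one, intervalIntegral.integral_of_le zero_le_one]
    refine integral_mono_of_nonneg (Filter.Eventually.of_forall fun t => Real.sqrt_nonneg _)
      (hint.mono_set Ioc_subset_Icc_self) (Filter.Eventually.of_forall fun t => ?_)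
    refine Real.sqrt_le_sqrt ?_
    have hcancel : ε⁻¹ ^ 2 * (ε * b 4 t) ^ 2 = b 4 t ^ 2 := by field_simp
    simp only [a, Fin.sum_univ_five, Matrix.cons_val, hcancel]
    nlinarith [sq_nonneg (b 2 t), sq_nonneg (b 3 t)]
  refine le_trans (csInf_le ⟨0, ?_⟩ ⟨fun t i => γ t (Fin.castAdd 3 i), a, ?_, ?_, ⟨L, ?_⟩, ?_, rfl⟩)
    hle
  · rintro _ ⟨_, _, _, _, _, _, rfl⟩
    exact intervalIntegral.integral_nonneg zero_le_one fun t _ => Real.sqrt_nonneg _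
  · ext i
    simp [h0, hJoin]
  · ext i
    simp [h1, hJoin]
  · intro s hs t ht
    exact (edist_pi_le_iff.2 fun i => edist_le_pi_edist (γ s) (γ t) _).trans (hL hs ht)
  · filter_upwards [hγ] with t ht
    refine hasDerivAt_pi.2 fun i => ?_
    refine (hasDerivAt_pi.1 ht (Fin.castAdd 3 i)).congr_deriv ?_
    fin_cases i <;>
      simp [a, lX1, lX2, lZ1, lZ2, lZ3eps, hX1, hX2, hX3, mul_comm]

/-- **Lemma (lifted distance dominates the distance below, up to a constant)**:
there is `C₀ > 0`, independent of `ε`, with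
`d̄_ε((x,z),(y,z)) ≥ d_ε(x,y) − C₀` for all `x, y, z`. -/
theorem lifted_distance_lower_bound :
    ∃ C₀ : ℝ, 0 < C₀ ∧ ∀ ε : ℝ, 0 < ε → ∀ x y z : Fin 3 → ℝ,
      dHeps ε x y - C₀ ≤ dLift ε (hJoin x z) (hJoin y z) := by
  refine ⟨1, one_pos, fun ε hε x y z => ?_⟩
  have hle : dHeps ε x y ≤ dLift ε (hJoin x z) (hJoin y z) := by
    refine le_csInf ?_ ?_
    · obtain ⟨γ, b, h0, h1, hL, hγ⟩ := exists_lift_curve hε x y z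
      exact ⟨_, γ, b, h0, h1, hL, Filter.Eventually.of_forall hγ, rfl⟩
    · rintro _ ⟨γ, b, h0, h1, hL, hγ, rfl⟩
      exact dHeps_le_length_of_lift hε h0 h1 hL hγ
  linarith

end
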